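/- arXiv:2605.09451 — 2 statements merged into one kernel-verified Lean document; each statement's English description precedes it below -/
import Mathlib

section
/- Let k be a positive integer with prime factorization k = p_1^{α_1} ··· p_r^{α_r}, and let n be a positive integer. There exist matrices A, B in M_n(ℂ) with (AB - BA)^k = Id_n if and only if n lies in ℕp_1 + ℕp_2 + ··· + ℕp_r (the set of nonnegative integer combinations of the prime divisors of k). -/
open Polynomial IntermediateField in
theorem totient_mul_natDegree_minpoly_adjoin {m d : ℕ} (hd : 0 < d) (hmd : m ∣ d) {ζ ξ η : ℂ}
    (hζ : IsPrimitiveRoot ζ m) (hη : IsPrimitiveRoot η d) (hξ : ξ ^ d = 1)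
    (hmem : η ∈ ℚ⟮ζ, ξ⟯) :
    m.totient * (minpoly ℚ⟮ζ⟯ ξ).natDegree = d.totient := by
  have hm : 0 < m := Nat.pos_of_dvd_of_pos hmd hd
  have : NeZero d := ⟨hd.ne'⟩
  have hpow : ∀ z : ℂ, z ^ d = 1 → z ∈ ℚ⟮η⟯ := fun z hz ↦ by
    obtain ⟨i, -, rfl⟩ := hη.eq_pow_of_pow_eq_one hz
    exact pow_mem (mem_adjoin_simple_self ℚ η) i
  have hadj : ℚ⟮ζ, ξ⟯ = ℚ⟮η⟯ := by
    apply le_antisymm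
    · rw [adjoin_le_iff]
      rintro z (rfl | rfl)
      · refine hpow _ ?_
        obtain ⟨c, rfl⟩ := hmd
        rw [pow_mul, hζ.pow_eq_one, one_pow]
      · exact hpow _ hξ
    · rwa [adjoin_simple_le_iff]
  have hdeg : ∀ {e : ℕ} {z : ℂ}, 0 < e → IsPrimitiveRoot z e →
      Module.finrank ℚ ℚ⟮z⟯ = e.totient := fun {e z} he hz ↦ by
    rw [adjoin.finrank (hz.isIntegral he).tower_top, ← cyclotomic_eq_minpoly_rat hz he,
      natDegree_cyclotomic]
  have hint : IsIntegral ℚ⟮ζ⟯ ξ := ⟨X ^ d - 1, monic_X_pow_sub_C 1 hd.ne', by simp [hξ]⟩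
  rw [← hdeg hm hζ, ← adjoin.finrank hint, ← hdeg hd hη, ← hadj,
    ← adjoin_simple_adjoin_simple]
  exact Module.finrank_mul_finrank ℚ ℚ⟮ζ⟯ ℚ⟮ζ⟯⟮ξ⟯

open Polynomial in
theorem exists_eq_const_of_sum_mul_pow_eq_zero {F : Type*} [Field F] [Algebra F ℂ] {p : ℕ}
    (hp : p.Prime) {ξ : ℂ} (hdeg : p ≤ (minpoly F ξ).natDegree ∨
      IsPrimitiveRoot ξ p ∧ (minpoly F ξ).natDegree = p - 1)
    (a : Fin p → F) (ha : ∑ i : Fin p, ξ ^ (i : ℕ) * algebraMap F ℂ (a i) = 0) :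
    ∃ c : F, (p ≤ (minpoly F ξ).natDegree → c = 0) ∧ ∀ i, a i = c := by
  have hp1 : p - 1 < p := Nat.sub_lt hp.pos one_pos
  let l : Fin p := ⟨p - 1, hp1⟩
  have key : ∀ b : Fin p → F, ∑ i : Fin p, ξ ^ (i : ℕ) * algebraMap F ℂ (b i) = 0 →
      (p ≤ (minpoly F ξ).natDegree ∨ (minpoly F ξ).natDegree = p - 1 ∧ b l = 0) →
      ∀ i, b i = 0 := by
    intro b hb h
    set f : F[X] := ∑ i : Fin p, C (b i) * X ^ (i : ℕ) with hf
    have hcoeff : ∀ i : Fin p, f.coeff i = b i := fun i ↦ by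
      simp [hf, finsetSum_coeff, coeff_C_mul, coeff_X_pow, Fin.val_inj]
    have hroot : aeval ξ f = 0 := by
      simpa only [hf, map_sum, map_mul, aeval_C, map_pow, aeval_X, mul_comm] using hb
    have hlt : f.degree < p := by
      refine (degree_sum_le _ _).trans_lt ((Finset.sup_lt_iff (WithBot.bot_lt_coe p)).2 ?_)
      exact fun i _ ↦ (degree_C_mul_X_pow_le _ _).trans_lt (Nat.cast_lt.2 i.2)
    have hf0 : f = 0 := by
      by_contra hne
      have h1 : (minpoly F ξ).natDegree ≤ f.natDegree :=
        natDegree_le_natDegree (minpoly.degree_le_of_ne_zero F ξ hne hroot)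
      have h2 : f.natDegree < p := (natDegree_lt_iff_degree_lt hne).2 hlt
      rcases h with h | ⟨h, hbl⟩
      · omega
      · have h3 : f.natDegree = p - 1 := by omega
        have h4 := hcoeff l
        rw [hbl, show (l : ℕ) = f.natDegree from h3.symm] at h4
        exact hne (leadingCoeff_eq_zero.1 h4)
    intro i
    rw [← hcoeff, hf0, coeff_zero]
  rcases hdeg with hdeg | ⟨hξ, hdeg⟩
  · exact ⟨0, fun _ ↦ rfl, key a ha (.inl hdeg)⟩
  · refine ⟨a l, fun h ↦ by omega, fun i ↦ sub_eq_zero.1 (key (fun i ↦ a i - a l) ?_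
      (.inr ⟨hdeg, sub_self _⟩) i)⟩
    have : ∑ i : Fin p, ξ ^ (i : ℕ) = 0 := by
      rw [Fin.sum_univ_eq_sum_range (fun i ↦ ξ ^ i)]
      exact hξ.geom_sum_eq_zero hp.one_lt
    simp [mul_sub, Finset.sum_sub_distrib, ha, ← Finset.sum_mul, this]

open IntermediateField in
theorem exists_coset_representatives {p m : ℕ} (hp : p.Prime) (hm : 0 < m) :
    ∃ g : Fin p → ℂ, (∀ z : ℂ, z ^ (p * m) = 1 → ∃ i y, y ^ m = 1 ∧ z = g i * y) ∧
      ∀ U V : Fin p → Multiset ℂ, (∀ i, ∀ z ∈ U i, z ^ m = 1) → (∀ i, ∀ z ∈ V i, z ^ m = 1) →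
        ∑ i, g i * (U i).sum = ∑ i, g i * (V i).sum →
        ∃ α : ℂ, (p ∣ m → α = 0) ∧ ∀ i, (U i).sum = (V i).sum + α := by
  have : NeZero m := ⟨hm.ne'⟩
  have : NeZero p := ⟨hp.ne_zero⟩
  have hpm : 0 < p * m := Nat.mul_pos hp.pos hm
  have hζ := Complex.isPrimitiveRoot_exp m hm.ne'
  set ζ := Complex.exp (2 * Real.pi * Complex.I / m)
  obtain ⟨ξ, hdeg, hdvd, hrep⟩ : ∃ ξ : ℂ, (p ≤ (minpoly ℚ⟮ζ⟯ ξ).natDegree ∨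
      IsPrimitiveRoot ξ p ∧ (minpoly ℚ⟮ζ⟯ ξ).natDegree = p - 1) ∧
      (p ∣ m → p ≤ (minpoly ℚ⟮ζ⟯ ξ).natDegree) ∧
      ∀ z : ℂ, z ^ (p * m) = 1 → ∃ (i : Fin p) (y : ℂ), y ^ m = 1 ∧ z = ξ ^ (i : ℕ) * y := by
    have htot : 0 < m.totient := Nat.totient_pos.2 hm
    by_cases h : p ∣ m
    · have hξ := Complex.isPrimitiveRoot_exp (p * m) hpm.ne'
      set ξ := Complex.exp (2 * Real.pi * Complex.I / (p * m : ℕ))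
      have hd : (minpoly ℚ⟮ζ⟯ ξ).natDegree = p := by
        have := totient_mul_natDegree_minpoly_adjoin hpm (Dvd.intro_left p rfl) hζ hξ
          hξ.pow_eq_one (subset_adjoin ℚ _ (by simp))
        rw [Nat.totient_mul_of_prime_of_dvd hp h, mul_comm p] at this
        exact Nat.eq_of_mul_eq_mul_left htot this
      refine ⟨ξ, .inl hd.ge, fun _ ↦ hd.ge, fun z hz ↦ ?_⟩
      have : NeZero (p * m) := ⟨hpm.ne'⟩
      obtain ⟨k, -, rfl⟩ := hξ.eq_pow_of_pow_eq_one hz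
      refine ⟨⟨k % p, Nat.mod_lt _ hp.pos⟩, ξ ^ (p * (k / p)), ?_, ?_⟩
      · rw [← pow_mul, mul_right_comm, pow_mul, hξ.pow_eq_one, one_pow]
      · rw [← pow_add, Nat.mod_add_div]
    · have hξ := Complex.isPrimitiveRoot_exp p hp.ne_zero
      set ξ := Complex.exp (2 * Real.pi * Complex.I / p)
      have hη : IsPrimitiveRoot (ξ * ζ) (p * m) := by
        have hco : p.Coprime m := (Nat.Prime.coprime_iff_not_dvd hp).2 h
        rw [hξ.eq_orderOf, hζ.eq_orderOf] at hco ⊢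
        rw [← (Commute.all ξ ζ).orderOf_mul_eq_mul_orderOf_of_coprime hco]
        exact IsPrimitiveRoot.orderOf _
      have hd : (minpoly ℚ⟮ζ⟯ ξ).natDegree = p - 1 := by
        have := totient_mul_natDegree_minpoly_adjoin (ξ := ξ) hpm (Dvd.intro_left p rfl) hζ hη
          (by rw [pow_mul, hξ.pow_eq_one, one_pow])
          (mul_mem (subset_adjoin ℚ _ (by simp)) (subset_adjoin ℚ _ (by simp)))
        rw [Nat.totient_mul_of_prime_of_not_dvd hp h, mul_comm (p - 1)] at this
        exact Nat.eq_of_mul_eq_mul_left htot this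
      refine ⟨ξ, .inr ⟨hξ, hd⟩, fun h' ↦ absurd h' h, fun z hz ↦ ?_⟩
      have : NeZero (p * m) := ⟨hpm.ne'⟩
      obtain ⟨k, -, rfl⟩ := hη.eq_pow_of_pow_eq_one hz
      refine ⟨⟨k % p, Nat.mod_lt _ hp.pos⟩, ζ ^ k, ?_, ?_⟩
      · rw [← pow_mul, mul_comm, pow_mul, hζ.pow_eq_one, one_pow]
      · conv_lhs => rw [mul_pow, ← Nat.mod_add_div k p, pow_add, pow_mul ξ p, hξ.pow_eq_one,
          one_pow, mul_one, Nat.mod_add_div]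
  refine ⟨fun i ↦ ξ ^ (i : ℕ), hrep, fun U V hU hV h ↦ ?_⟩
  have hsum : ∀ W : Multiset ℂ, (∀ z ∈ W, z ^ m = 1) → W.sum ∈ ℚ⟮ζ⟯ := fun W hW ↦ by
    refine multiset_sum_mem _ fun z hz ↦ ?_
    obtain ⟨i, -, rfl⟩ := hζ.eq_pow_of_pow_eq_one (hW z hz)
    exact pow_mem (mem_adjoin_simple_self ℚ ζ) i
  obtain ⟨c, hc0, hc⟩ := exists_eq_const_of_sum_mul_pow_eq_zero hp hdeg
    (fun i ↦ ⟨(U i).sum - (V i).sum, sub_mem (hsum _ (hU i)) (hsum _ (hV i))⟩)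
    (by simpa [mul_sub, Finset.sum_sub_distrib, sub_eq_zero] using h)
  refine ⟨c, fun h ↦ by simp [hc0 (hdvd h)], fun i ↦ ?_⟩
  rw [← hc i]
  simp

theorem exists_decomposition_of_coset_representatives {p m : ℕ} {g : Fin p → ℂ}
    (hg : ∀ z : ℂ, z ^ (p * m) = 1 → ∃ i y, y ^ m = 1 ∧ z = g i * y) (u : Multiset ℂ)
    (hu : ∀ z ∈ u, z ^ (p * m) = 1) :
    ∃ U : Fin p → Multiset ℂ, (∀ i, ∀ z ∈ U i, z ^ m = 1) ∧
      u = ∑ i, (U i).map (g i * ·) := by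
  induction u using Multiset.induction_on with
  | empty => exact ⟨fun _ ↦ 0, by simp, by simp⟩
  | cons z u ih =>
    obtain ⟨U, hU, rfl⟩ := ih fun w hw ↦ hu w (Multiset.mem_cons_of_mem hw)
    obtain ⟨i, y, hy, rfl⟩ := hg z (hu z (Multiset.mem_cons_self z _))
    refine ⟨fun j ↦ U j + if j = i then {y} else 0, fun j w hw ↦ ?_, ?_⟩
    · rcases Multiset.mem_add.1 hw with hw | hw
      · exact hU j w hw
      · split_ifs at hw <;> simp_all
    · simp only [Multiset.map_add, Finset.sum_add_distrib]
      rw [Finset.sum_eq_single (f := fun j ↦ Multiset.map _ (if j = i then {y} else 0)) i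
        (fun j _ hj ↦ by simp [hj]) (by simp)]
      simp [add_comm, ← Multiset.singleton_add]

theorem exists_compatible_decompositions {p m : ℕ} (hp : p.Prime) (hm : 0 < m) {u v : Multiset ℂ}
    (hu : ∀ z ∈ u, z ^ (p * m) = 1) (hv : ∀ z ∈ v, z ^ (p * m) = 1) (h : u.sum = v.sum) :
    ∃ (g : Fin p → ℂ) (U V : Fin p → Multiset ℂ) (α : ℂ),
      (∀ i, ∀ z ∈ U i, z ^ m = 1) ∧ (∀ i, ∀ z ∈ V i, z ^ m = 1) ∧
      u = ∑ i, (U i).map (g i * ·) ∧ v = ∑ i, (V i).map (g i * ·) ∧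
      (p ∣ m → α = 0) ∧ ∀ i, (U i).sum = (V i).sum + α := by
  obtain ⟨g, hg, hind⟩ := exists_coset_representatives hp hm
  obtain ⟨U, hU, rfl⟩ := exists_decomposition_of_coset_representatives hg u hu
  obtain ⟨V, hV, rfl⟩ := exists_decomposition_of_coset_representatives hg v hv
  obtain ⟨α, hα, hUV⟩ := hind U V hU hV (by
    simpa [Multiset.sum_sum, Multiset.sum_map_mul_left (f := fun x ↦ x)] using h)
  exact ⟨g, U, V, α, hU, hV, rfl, rfl, hα, hUV⟩

theorem sum_eq_card_of_forall_eq_one {u : Multiset ℂ} (hu : ∀ z ∈ u, z = 1) :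
    u.sum = Multiset.card u := by
  rw [Multiset.eq_replicate_card.2 hu]
  simp

theorem exists_eq_zero_of_card_sum_lt {p : ℕ} {V : Fin p → Multiset ℂ}
    (hV : ∑ i, Multiset.card (V i) < p) : ∃ j, V j = 0 := by
  by_contra! h
  have : ∑ _i : Fin p, 1 ≤ ∑ i, Multiset.card (V i) :=
    Finset.sum_le_sum fun i _ ↦ Multiset.card_pos.2 (h i)
  simp at this
  omega

theorem le_of_sum_eq_of_pow_prime_pow_eq_one {a : ℕ} (ha : a.Prime) (e : ℕ) {u v : Multiset ℂ}
    (hu : ∀ z ∈ u, z ^ a ^ e = 1) (hv : ∀ z ∈ v, z ^ a ^ e = 1) (h : u.sum = v.sum)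
    (hva : Multiset.card v < a) : v ≤ u := by
  induction e generalizing u v with
  | zero =>
    simp only [pow_zero, pow_one] at hu hv
    rw [sum_eq_card_of_forall_eq_one hu, sum_eq_card_of_forall_eq_one hv, Nat.cast_inj] at h
    rw [Multiset.eq_replicate_card.2 hu, Multiset.eq_replicate_card.2 hv, h]
  | succ e ih =>
    simp only [pow_succ'] at hu hv
    obtain ⟨g, U, V, α, hU, hV, rfl, rfl, hα, hUV⟩ :=
      exists_compatible_decompositions ha (pow_pos ha.pos e) hu hv h
    simp only [Multiset.card_sum, Multiset.card_map] at hva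
    refine Finset.sum_le_sum fun i _ ↦ Multiset.map_le_map ?_
    obtain rfl | he := e.eq_zero_or_pos
    · simp only [pow_zero, pow_one] at hU hV
      obtain ⟨j, hj⟩ := exists_eq_zero_of_card_sum_lt hva
      have h1 := hUV j
      have h2 := hUV i
      rw [hj, Multiset.sum_zero, zero_add] at h1
      rw [← h1, sum_eq_card_of_forall_eq_one (hU i), sum_eq_card_of_forall_eq_one (hV i),
        sum_eq_card_of_forall_eq_one (hU j)] at h2
      rw [Multiset.eq_replicate_card.2 (hU i), Multiset.eq_replicate_card.2 (hV i),
        Multiset.replicate_le_replicate]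
      norm_cast at h2
      omega
    · refine ih (hU i) (hV i) ?_ (lt_of_le_of_lt ?_ hva)
      · rw [hUV i, hα (dvd_pow_self a he.ne'), add_zero]
      · exact Finset.single_le_sum (f := fun i ↦ Multiset.card (V i)) (fun _ _ ↦ Nat.zero_le _)
          (Finset.mem_univ i)

theorem dvd_card_of_sum_eq_zero_of_pow_prime_pow_eq_one {a : ℕ} (ha : a.Prime) {e : ℕ}
    (he : 0 < e) {u : Multiset ℂ} (hu : ∀ z ∈ u, z ^ a ^ e = 1) (h : u.sum = 0) :
    a ∣ Multiset.card u := by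
  induction e, he using Nat.le_induction generalizing u with
  | base =>
    obtain ⟨g, U, V, α, hU, -, rfl, hV, -, hUV⟩ :=
      exists_compatible_decompositions (m := 1) (v := 0) ha one_pos
        (by simpa using hu) (by simp) (by simpa using h)
    have hV0 : ∀ i, V i = 0 := by simpa [Finset.sum_eq_zero_iff] using hV.symm
    simp only [pow_one] at hU
    have hcard : ∀ i, (Multiset.card (U i) : ℂ) = α := fun i ↦ by
      rw [← sum_eq_card_of_forall_eq_one (hU i), hUV i, hV0 i, Multiset.sum_zero, zero_add]
    have hc : ∀ i, Multiset.card (U i) = Multiset.card (U ⟨0, ha.pos⟩) := fun i ↦ by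
      exact_mod_cast (hcard i).trans (hcard _).symm
    simp [Multiset.card_sum, hc]
  | succ e he ih =>
    simp only [pow_succ'] at hu
    obtain ⟨g, U, V, α, hU, -, rfl, hV, hα, hUV⟩ :=
      exists_compatible_decompositions (v := 0) ha (pow_pos ha.pos e) hu (by simp)
        (by simpa using h)
    have hV0 : ∀ i, V i = 0 := by simpa [Finset.sum_eq_zero_iff] using hV.symm
    simp only [Multiset.card_sum, Multiset.card_map]
    refine Finset.dvd_sum fun i _ ↦ ih (hU i) ?_
    rw [hUV i, hV0 i, hα (dvd_pow_self a (Nat.one_le_iff_ne_zero.1 he)), Multiset.sum_zero,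
      zero_add]

theorem card_add_pred_mul_le_sum_add {p w : ℕ} (x y : Fin p → ℕ) (i : Fin p)
    (h : ∀ j, y j = 0 → w ≤ x j) :
    x i + (p - 1) * w + y i * w ≤ ∑ j, x j + (∑ j, y j) * w := by
  have hle : ∑ _j ∈ Finset.univ.erase i, w ≤ ∑ j ∈ Finset.univ.erase i, (x j + y j * w) := by
    refine Finset.sum_le_sum fun j _ ↦ ?_
    rcases (y j).eq_zero_or_pos with hy | hy
    · exact (h j hy).trans (Nat.le_add_right _ _)
    · exact (Nat.le_mul_of_pos_left w hy).trans (Nat.le_add_left _ _)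
  rw [Finset.sum_const, Finset.card_erase_of_mem (Finset.mem_univ i), Finset.card_univ,
    Fintype.card_fin, smul_eq_mul, Finset.sum_add_distrib, ← Finset.sum_mul] at hle
  rw [← Finset.add_sum_erase _ x (Finset.mem_univ i),
    ← Finset.add_sum_erase _ y (Finset.mem_univ i), add_mul]
  omega

theorem le_or_mul_le_card_of_sum_eq {a b e : ℕ} (ha : a.Prime) (hab : a < b) (l : ℕ) (hl0 : l ≠ 0)
    (hl : ∀ q, q.Prime → q ∣ l → b ≤ q) {u v : Multiset ℂ}
    (hu : ∀ z ∈ u, z ^ (l * a ^ e) = 1) (hv : ∀ z ∈ v, z ^ (l * a ^ e) = 1)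
    (h : u.sum = v.sum) (hva : Multiset.card v < a) :
    v ≤ u ∨ (a - Multiset.card v) * (b - 1) ≤ Multiset.card u := by
  induction l using induction_on_primes generalizing u v with
  | zero => exact absurd rfl hl0
  | one =>
    simp only [one_mul] at hu hv
    exact .inl (le_of_sum_eq_of_pow_prime_pow_eq_one ha e hu hv h hva)
  | prime_mul p l hp ih =>
    have hl0' : l ≠ 0 := right_ne_zero_of_mul hl0
    replace ih := @ih hl0' fun q hq hql ↦ hl q hq (hql.mul_left p)
    have hbp : b ≤ p := hl p hp (Dvd.intro l rfl)
    rw [mul_assoc] at hu hv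
    obtain ⟨g, U, V, α, hU, hV, rfl, rfl, -, hUV⟩ := exists_compatible_decompositions hp
      (Nat.mul_pos (Nat.pos_of_ne_zero hl0') (pow_pos ha.pos e)) hu hv h
    simp only [Multiset.card_sum, Multiset.card_map] at hva ⊢
    obtain ⟨j₀, hj₀⟩ := exists_eq_zero_of_card_sum_lt (hva.trans (hab.trans_le hbp))
    obtain ⟨j, hj, hmin⟩ := Finset.exists_min_image (Finset.univ.filter fun j ↦ V j = 0)
      (fun j ↦ Multiset.card (U j)) ⟨j₀, by simpa using hj₀⟩
    simp only [Finset.mem_filter, Finset.mem_univ, true_and] at hj hmin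
    by_cases hle : ∀ i, V i ≤ U i
    · exact .inl (Finset.sum_le_sum fun i _ ↦ Multiset.map_le_map (hle i))
    right
    obtain ⟨i, hi⟩ := not_forall.1 hle
    have hcount := card_add_pred_mul_le_sum_add (fun j ↦ Multiset.card (U j))
      (fun j ↦ Multiset.card (V j)) i fun j' hj' ↦ hmin j' (Multiset.card_eq_zero.1 hj')
    have hrec : Multiset.card (V i) + Multiset.card (U j) < a →
        (a - (Multiset.card (V i) + Multiset.card (U j))) * (b - 1) ≤ Multiset.card (U i) := by
      intro hlt
      refine (ih (hU i) (v := V i + U j) ?_ ?_ (by simpa using hlt)).resolve_left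
        (fun h' ↦ hi ((Multiset.le_add_right _ _).trans h')) |>.trans' (by simp)
      · exact fun z hz ↦ (Multiset.mem_add.1 hz).elim (hV i z) (hU j z)
      · rw [Multiset.sum_add, hUV i, hUV j, hj, Multiset.sum_zero, zero_add]
    have hsV : Multiset.card (V i) ≤ ∑ i, Multiset.card (V i) :=
      Finset.single_le_sum (f := fun i ↦ Multiset.card (V i)) (fun _ _ ↦ Nat.zero_le _)
        (Finset.mem_univ i)
    generalize (∑ i, Multiset.card (U i)) = N at *
    generalize (∑ i, Multiset.card (V i)) = t at *
    generalize Multiset.card (V i) = s at *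
    generalize Multiset.card (U i) = x at *
    generalize Multiset.card (U j) = w at *
    clear hmin ih hUV hU hV
    obtain ⟨d, rfl⟩ := Nat.exists_eq_add_of_le hsV
    obtain ⟨B, rfl⟩ : ∃ B, b = B + 1 := ⟨b - 1, by omega⟩
    obtain ⟨q, rfl⟩ : ∃ q, p = B + 1 + q := Nat.exists_eq_add_of_le hbp
    obtain ⟨f, rfl⟩ := Nat.exists_eq_add_of_lt hva
    have e1 : s + d + f + 1 - (s + d) = f + 1 := by omega
    have e2 : B + 1 + q - 1 = B + q := by omega
    rw [e1, Nat.add_sub_cancel]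
    rw [e2] at hcount
    by_cases hlt : s + w < s + d + f + 1
    · obtain ⟨c, hc⟩ := Nat.exists_eq_add_of_lt hlt
      have h1 := hrec hlt
      have e3 : s + d + f + 1 - (s + w) = c + 1 := by omega
      rw [e3, Nat.add_sub_cancel] at h1
      have hw : w ≤ B := by omega
      have hwd := Nat.mul_le_mul_left d hw
      have hfc : f + 1 + d = c + 1 + w := by omega
      have : (f + 1 + d) * B = (c + 1 + w) * B := by rw [hfc]
      nlinarith [Nat.zero_le (q * w)]
    · obtain ⟨y, rfl⟩ : ∃ y, w = d + f + 1 + y := Nat.exists_eq_add_of_le (by omega)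
      obtain ⟨C, rfl⟩ : ∃ C, B = s + d + f + 1 + C := Nat.exists_eq_add_of_le (by omega)
      nlinarith [Nat.zero_le (q * (d + f + 1 + y)), Nat.zero_le (y * (s + f + 1 + C)),
        Nat.zero_le (d * (s + C)), Nat.zero_le x]

theorem prime_mem_closure {q k : ℕ} (hq : q.Prime) (hqk : q ∣ k) :
    q ∈ AddSubmonoid.closure {q | q.Prime ∧ q ∣ k} :=
  AddSubmonoid.subset_closure (Set.mem_ofPred.2 ⟨hq, hqk⟩)

theorem card_mem_closure_of_sum_eq_zero_of_card_lt {a b e : ℕ} (ha : a.Prime) (hab : a < b) (l : ℕ)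
    (hl0 : l ≠ 0) (hl : ∀ q, q.Prime → q ∣ l → b ≤ q) {u : Multiset ℂ}
    (hu : ∀ z ∈ u, z ^ (l * a ^ e) = 1) (h : u.sum = 0)
    (hcard : Multiset.card u < (a - 1) * (b - 1)) :
    Multiset.card u ∈ AddSubmonoid.closure {q | q.Prime ∧ q ∣ l * a ^ e} := by
  induction l using induction_on_primes generalizing u with
  | zero => exact absurd rfl hl0
  | one =>
    simp only [one_mul] at hu ⊢
    obtain rfl | he := e.eq_zero_or_pos
    · rw [sum_eq_card_of_forall_eq_one (by simpa using hu), Nat.cast_eq_zero] at h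
      rw [h]
      exact zero_mem _
    · obtain ⟨c, hc⟩ := dvd_card_of_sum_eq_zero_of_pow_prime_pow_eq_one ha he hu h
      rw [hc, mul_comm, ← smul_eq_mul]
      exact nsmul_mem (prime_mem_closure ha (dvd_pow_self a he.ne')) c
  | prime_mul p l hp ih =>
    have hl0' : l ≠ 0 := right_ne_zero_of_mul hl0
    have hl' : ∀ q, q.Prime → q ∣ l → b ≤ q := fun q hq hql ↦ hl q hq (hql.mul_left p)
    have hbp : b ≤ p := hl p hp (Dvd.intro l rfl)
    rw [mul_assoc] at hu ⊢
    obtain ⟨g, U, V, α, hU, -, rfl, hV, -, hUV⟩ := exists_compatible_decompositions (v := 0) hp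
      (Nat.mul_pos (Nat.pos_of_ne_zero hl0') (pow_pos ha.pos e)) hu (by simp) (by simpa using h)
    have hV0 : ∀ i, V i = 0 := by simpa [Finset.sum_eq_zero_iff] using hV.symm
    replace hUV : ∀ i, (U i).sum = α := fun i ↦ by simp [hUV i, hV0 i]
    simp only [Multiset.card_sum, Multiset.card_map] at hcard ⊢
    obtain ⟨j, -, hmin⟩ := Finset.exists_min_image Finset.univ (fun j ↦ Multiset.card (U j))
      ⟨⟨0, hp.pos⟩, Finset.mem_univ _⟩
    have hcount : ∀ i, Multiset.card (U i) + (p - 1) * Multiset.card (U j) ≤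
        ∑ i, Multiset.card (U i) := fun i ↦ by
      simpa using card_add_pred_mul_le_sum_add (fun j ↦ Multiset.card (U j)) (fun _ ↦ 0) i
        fun j' _ ↦ hmin j' (Finset.mem_univ j')
    have hb1 : ∀ w, (b - 1) * w ≤ (p - 1) * w := fun w ↦
      Nat.mul_le_mul_right w (Nat.sub_le_sub_right hbp 1)
    have hlt : Multiset.card (U j) < a := by
      have := (hb1 _).trans_lt ((Nat.le_add_left _ _).trans_lt ((hcount j).trans_lt hcard))
      rw [mul_comm] at this
      exact (lt_of_mul_lt_mul_right this (Nat.zero_le _)).trans_le (Nat.sub_le _ _)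
    have hle : ∀ i, U j ≤ U i := fun i ↦ by
      refine (le_or_mul_le_card_of_sum_eq ha hab l hl0' hl' (hU i) (hU j)
        ((hUV i).trans (hUV j).symm) hlt).resolve_right fun h' ↦ ?_
      have h1 := hcount i
      have h2 := hb1 (Multiset.card (U j))
      have h3 : (a - Multiset.card (U j)) * (b - 1) + (b - 1) * Multiset.card (U j) =
          a * (b - 1) := by
        rw [mul_comm (b - 1), ← add_mul, Nat.sub_add_cancel hlt.le]
      have h4 : (a - 1) * (b - 1) ≤ a * (b - 1) := Nat.mul_le_mul_right _ (Nat.sub_le _ _)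
      omega
    have hsum : ∑ i, Multiset.card (U i) =
        Multiset.card (U j) • p + ∑ i, Multiset.card (U i - U j) := by
      rw [smul_eq_mul, mul_comm]
      have : p * Multiset.card (U j) = ∑ _i : Fin p, Multiset.card (U j) := by simp
      rw [this, ← Finset.sum_add_distrib]
      refine Finset.sum_congr rfl fun i _ ↦ ?_
      rw [← Multiset.card_add, add_tsub_cancel_of_le (hle i)]
    rw [hsum]
    refine add_mem (nsmul_mem (prime_mem_closure hp (Dvd.intro _ rfl)) _)
      (sum_mem fun i _ ↦ ?_)
    refine AddSubmonoid.closure_mono (fun q hq ↦ Set.mem_ofPred.2 ⟨hq.1, hq.2.mul_left p⟩)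
      (ih hl0' hl' (fun z hz ↦ hU i z (Multiset.mem_of_le tsub_le_self hz)) ?_ ?_)
    · have := congrArg Multiset.sum (add_tsub_cancel_of_le (hle i))
      rw [Multiset.sum_add, hUV, hUV] at this
      simpa using this
    · refine lt_of_le_of_lt ((Multiset.card_le_card tsub_le_self).trans ?_) hcard
      exact (Nat.le_add_right _ _).trans (hcount i)

/-- The **Lam–Leung theorem**: the number of terms in a vanishing sum of `k`-th roots of unity is a
sum of prime divisors of `k`. -/
theorem card_mem_closure_of_sum_eq_zero {k : ℕ} (hk : k ≠ 0) {u : Multiset ℂ}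
    (hu : ∀ z ∈ u, z ^ k = 1) (h : u.sum = 0) :
    Multiset.card u ∈ AddSubmonoid.closure {q | q.Prime ∧ q ∣ k} := by
  obtain rfl | hk1 := eq_or_ne k 1
  · rw [sum_eq_card_of_forall_eq_one (by simpa using hu), Nat.cast_eq_zero] at h
    rw [h]
    exact zero_mem _
  have ha := Nat.minFac_prime hk1
  have hak := Nat.minFac_dvd k
  have hamin : ∀ q, q.Prime → q ∣ k → k.minFac ≤ q := fun q hq ↦ Nat.minFac_le_of_dvd hq.two_le
  generalize k.minFac = a at *
  obtain ⟨e, l, hal, hkl⟩ := Nat.exists_eq_pow_mul_and_not_dvd hk a ha.ne_one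
  rw [mul_comm] at hkl
  have hl0 : l ≠ 0 := by
    rintro rfl
    exact hal (dvd_zero a)
  obtain rfl | hl1 := eq_or_ne l 1
  · rw [hkl] at hu ⊢
    refine card_mem_closure_of_sum_eq_zero_of_card_lt ha (b := a + Multiset.card u + 2)
      (by omega) 1 hl0 (fun q hq hq1 ↦ absurd (Nat.dvd_one.1 hq1) hq.ne_one) hu h ?_
    have := ha.two_le
    refine lt_of_lt_of_le ?_ (Nat.le_mul_of_pos_left _ (by omega))
    omega
  · have hb := Nat.minFac_prime hl1
    have hbl := Nat.minFac_dvd l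
    have hbk : l.minFac ∣ k := hbl.trans ⟨_, hkl⟩
    have hab : a < l.minFac := lt_of_le_of_ne (hamin _ hb hbk) (by
      rintro rfl
      exact hal hbl)
    by_cases hcard : Multiset.card u < (a - 1) * (l.minFac - 1)
    · rw [hkl] at hu ⊢
      exact card_mem_closure_of_sum_eq_zero_of_card_lt ha hab l hl0
        (fun q hq ↦ Nat.minFac_le_of_dvd hq.two_le) hu h hcard
    · obtain ⟨x, y, hxy⟩ := Nat.exists_add_mul_eq_of_gcd_dvd_of_mul_pred_le a l.minFac
        (Multiset.card u) (by
          rw [(Nat.coprime_primes ha hb).2 hab.ne]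
          exact one_dvd _) (not_lt.1 hcard)
      rw [← hxy, ← smul_eq_mul, ← smul_eq_mul]
      exact add_mem (nsmul_mem (prime_mem_closure ha hak) _)
        (nsmul_mem (prime_mem_closure hb hbk) _)

theorem Matrix.exists_commutator_of_diag_eq_zero {n : ℕ} {M : Matrix (Fin n) (Fin n) ℂ}
    (hM : ∀ i, M i i = 0) : ∃ A B, A * B - B * A = M := by
  refine ⟨Matrix.diagonal fun i ↦ ((i : ℕ) : ℂ),
    Matrix.of fun i j ↦ M i j / (((i : ℕ) : ℂ) - ((j : ℕ) : ℂ)), ?_⟩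
  ext i j
  rw [Matrix.sub_apply, Matrix.diagonal_mul, Matrix.mul_diagonal, Matrix.of_apply]
  obtain rfl | hij := eq_or_ne i j
  · simp [hM]
  · have : ((i : ℕ) : ℂ) - ((j : ℕ) : ℂ) ≠ 0 := by
      rwa [sub_ne_zero, Nat.cast_inj.ne, Fin.val_ne_iff]
    field_simp

theorem exists_commutator_pow_eq_one_of_cycleType {n k : ℕ} {s : Multiset ℕ}
    (hs : ∀ q ∈ s, 2 ≤ q ∧ q ∣ k) (hn : s.sum = n) :
    ∃ A B : Matrix (Fin n) (Fin n) ℂ, (A * B - B * A) ^ k = 1 := by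
  obtain ⟨σ, hσ⟩ := (Equiv.Perm.exists_with_cycleType_iff (Fin n) (m := s)).2
    ⟨by simp [hn], fun q hq ↦ (hs q hq).1⟩
  have hσk : σ ^ k = 1 := by
    rw [← orderOf_dvd_iff_pow_eq_one, ← Equiv.Perm.lcm_cycleType, hσ]
    exact Multiset.lcm_dvd.2 fun q hq ↦ (hs q hq).2
  have hsupp : σ.support = Finset.univ := by
    rw [← Finset.card_eq_iff_eq_univ, ← Equiv.Perm.sum_cycleType, hσ, hn, Fintype.card_fin]
  have hfix : ∀ i, σ i ≠ i := fun i ↦ by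
    rw [← Equiv.Perm.mem_support, hsupp]
    exact Finset.mem_univ i
  obtain ⟨A, B, hAB⟩ := Matrix.exists_commutator_of_diag_eq_zero (M := σ.permMatrix ℂ)
    fun i ↦ by simp [Equiv.Perm.permMatrix, PEquiv.toMatrix_apply, hfix i]
  have hpow : ∀ j : ℕ, (σ.permMatrix ℂ) ^ j = (σ ^ j).permMatrix ℂ := fun j ↦ by
    induction j with
    | zero => simp
    | succ j ih => rw [pow_succ, ih, pow_succ', Matrix.permMatrix_mul]
  exact ⟨A, B, by rw [hAB, hpow, hσk, Matrix.permMatrix_one]⟩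

theorem mem_closure_of_trace_eq_zero_of_pow_eq_one {n k : ℕ} (hn : 0 < n) (hk : k ≠ 0)
    {M : Matrix (Fin n) (Fin n) ℂ} (htr : M.trace = 0) (hM : M ^ k = 1) :
    n ∈ AddSubmonoid.closure {q | q.Prime ∧ q ∣ k} := by
  have : Nonempty (Fin n) := ⟨⟨0, hn⟩⟩
  have hcard : Multiset.card M.charpoly.roots = n := by
    rw [IsAlgClosed.card_roots_eq_natDegree, Matrix.charpoly_natDegree_eq_dim, Fintype.card_fin]
  rw [← hcard]
  refine card_mem_closure_of_sum_eq_zero hk (fun z hz ↦ ?_)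
    (by rw [← Matrix.trace_eq_sum_roots_charpoly, htr])
  have h1 := spectrum.pow_mem_pow M k
    (Matrix.mem_spectrum_of_isRoot_charpoly (Polynomial.isRoot_of_mem_roots hz))
  rwa [hM, spectrum.one_eq, Set.mem_singleton_iff] at h1

theorem stmt_2 (r : ℕ) (p α : Fin r → ℕ) (hp : ∀ i, Nat.Prime (p i))
    (hpinj : Function.Injective p) (hα : ∀ i, 0 < α i)
    (k : ℕ) (hk : k = ∏ i, p i ^ α i) (n : ℕ) (hn : 0 < n) :
    (∃ A B : Matrix (Fin n) (Fin n) ℂ, (A * B - B * A) ^ k = 1) ↔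
      ∃ c : Fin r → ℕ, n = ∑ i, c i * p i := by
  constructor
  · rintro ⟨A, B, h⟩
    have hk0 : k ≠ 0 := by
      rw [hk]
      exact Finset.prod_ne_zero_iff.2 fun i _ ↦ pow_ne_zero _ (hp i).ne_zero
    have hmem := mem_closure_of_trace_eq_zero_of_pow_eq_one hn hk0
      (by rw [Matrix.trace_sub, Matrix.trace_mul_comm, sub_self]) h
    clear h hn A B
    induction hmem using AddSubmonoid.closure_induction with
    | mem q hq =>
      obtain ⟨hq, hqk⟩ := hq
      rw [hk, hq.prime.dvd_finsetProd_iff] at hqk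
      obtain ⟨i, -, hi⟩ := hqk
      rw [(Nat.prime_dvd_prime_iff_eq hq (hp i)).1 (hq.dvd_of_dvd_pow hi)]
      exact ⟨Pi.single i 1, by simp [Pi.single_apply]⟩
    | zero => exact ⟨0, by simp⟩
    | add x y _ _ hx hy =>
      obtain ⟨c, rfl⟩ := hx
      obtain ⟨d, rfl⟩ := hy
      exact ⟨c + d, by simp [add_mul, Finset.sum_add_distrib]⟩
  · rintro ⟨c, hc⟩
    refine exists_commutator_pow_eq_one_of_cycleType
      (s := ∑ i, Multiset.replicate (c i) (p i)) (fun q hq ↦ ?_) (by simp [Multiset.sum_sum, hc])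
    obtain ⟨i, -, hi⟩ := Multiset.mem_sum.1 hq
    rw [Multiset.eq_of_mem_replicate hi, hk]
    exact ⟨(hp i).two_le, (dvd_pow_self _ (hα i).ne').trans
      (Finset.dvd_prod_of_mem (fun i ↦ p i ^ α i) (Finset.mem_univ i))⟩
end

section
/- Let S be a unital ring and n ≥ 2. If the element n - 1 (i.e., the image of the integer n-1 in S) is a central unit of S, then there exist A, B ∈ M_n(S) with (AB - BA)^n = Id_n. -/
theorem Matrix.permMatrix_pow {ι R : Type*} [Fintype ι] [DecidableEq ι] [Semiring R]
    (σ : Equiv.Perm ι) (k : ℕ) : (σ ^ k).permMatrix R = σ.permMatrix R ^ k := by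
  induction k with
  | zero => simp
  | succ k ih => rw [pow_succ', pow_succ, Matrix.permMatrix_mul, ih]

/-- If `m + 1` has a right inverse, the permutation matrix of the cyclic shift is a commutator. -/
theorem exists_commutator_eq_permMatrix_addRight {S : Type*} [Ring S] (m : ℕ) {u : S}
    (hu : ((m : S) + 1) * u = 1) :
    ∃ A B : Matrix (Fin (m + 2)) (Fin (m + 2)) S,
      A * B - B * A = (Equiv.addRight (1 : Fin (m + 2))).permMatrix S := by
  refine ⟨Matrix.diagonal fun i => (i.val : S),
    Matrix.of fun i j => if j = i + 1 then (if i = Fin.last (m + 1) then u else -1) else 0, ?_⟩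
  ext i j
  simp only [Matrix.sub_apply, Matrix.diagonal_mul, Matrix.mul_diagonal, Matrix.of_apply,
    Equiv.Perm.permMatrix, PEquiv.toMatrix_apply, Equiv.toPEquiv_apply, Option.mem_def,
    Option.some.injEq, Equiv.coe_addRight]
  by_cases hj : j = i + 1
  · subst hj
    by_cases hi : i = Fin.last (m + 1)
    · subst hi
      simp [hu]
    · have h : (i + 1).val = i.val + 1 := Fin.val_add_one_of_lt (Fin.lt_last_iff_ne_last.2 hi)
      simp [hi, h]
  · simp [hj, Ne.symm hj]

theorem stmt_10 (S : Type*) [Ring S] (n : ℕ) (hn : 2 ≤ n)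
    (hc : ((n : S) - 1) ∈ Set.center S) (hu : IsUnit ((n : S) - 1)) :
    ∃ A B : Matrix (Fin n) (Fin n) S, (A * B - B * A) ^ n = 1 := by
  obtain ⟨m, rfl⟩ := Nat.exists_eq_add_of_le' hn
  obtain ⟨u, hu⟩ := hu.exists_right_inv
  have h : ((m + 2 : ℕ) : S) - 1 = m + 1 := by
    rw [sub_eq_iff_eq_add]; push_cast; rw [add_assoc, one_add_one_eq_two]
  rw [h] at hu
  obtain ⟨A, B, hAB⟩ := exists_commutator_eq_permMatrix_addRight m hu
  refine ⟨A, B, ?_⟩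
  have hσ : Equiv.addRight (1 : Fin (m + 2)) ^ (m + 2) = 1 := by
    ext i
    have h0 : (m + 2) • (1 : Fin (m + 2)) = 0 := by
      simpa only [Nat.card_fin] using card_nsmul_eq_zero' (x := (1 : Fin (m + 2)))
    simp [h0]
  rw [hAB, ← Matrix.permMatrix_pow, hσ, Matrix.permMatrix_one]
end
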